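/- arXiv:1508.04948 — 2 statements merged into one kernel-verified Lean document; each statement's English description precedes it below -/
import Mathlib

section
/- Let d > 0, p > 0, θ_0 > 0, n ≥ 1, and let S be a random variable with the Gamma distribution with shape n·d/p and rate θ_0^{−p}. Then E[( ((p/(n d))·S)^{1/p} − θ_0 )²] = θ_0² · ( 1 − 2·(p/(n d))^{1/p}·Γ((n d + 1)/p)/Γ(n d / p) + (p/(n d))^{2/p}·Γ((n d + 2)/p)/Γ(n d / p) ). -/
open MeasureTheory ProbabilityTheory

theorem measurable_gammaPDF (a r : ℝ) : Measurable (gammaPDF a r) :=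
  (measurable_gammaPDFReal a r).ennreal_ofReal

/-- The real power moments of the Gamma distribution. -/
theorem integral_rpow_gammaMeasure {a r s : ℝ} (ha : 0 < a) (hr : 0 < r) (hs : 0 < a + s) :
    ∫ x, x ^ s ∂(gammaMeasure a r) = r ^ (-s) * Real.Gamma (a + s) / Real.Gamma a := by
  have hdens : ∀ᵐ x : ℝ, (gammaPDF a r x).toReal • x ^ s = (Set.Ioi (0 : ℝ)).indicator
      (fun x ↦ r ^ a / Real.Gamma a * (x ^ (a + s - 1) * Real.exp (-(r * x)))) x := by
    filter_upwards [Measure.ae_ne volume (0 : ℝ)] with x hx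
    rcases hx.lt_or_gt with h | h
    · simp [gammaPDF_of_neg h, h.le]
    · rw [Set.indicator_of_mem (Set.mem_Ioi.2 h), gammaPDF,
        ENNReal.toReal_ofReal (gammaPDFReal_nonneg ha hr x), gammaPDFReal, if_pos h.le,
        show a + s - 1 = (a - 1) + s by ring, Real.rpow_add h, smul_eq_mul]
      ring
  rw [gammaMeasure, integral_withDensity_eq_integral_toReal_smul (measurable_gammaPDF a r)
      (ae_of_all _ fun x ↦ ENNReal.ofReal_lt_top), integral_congr_ae hdens,
    integral_indicator measurableSet_Ioi, integral_const_mul,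
    Real.integral_rpow_mul_exp_neg_mul_Ioi hs hr, one_div, Real.inv_rpow hr.le,
    ← Real.rpow_neg hr.le, show -s = a + -(a + s) by ring, Real.rpow_add hr]
  ring

/-- A power `x ^ s` is integrable for the Gamma distribution of shape `a` if `-a < s`. -/
theorem integrable_rpow_gammaMeasure {a r s : ℝ} (ha : 0 < a) (hr : 0 < r) (hs : 0 < a + s) :
    Integrable (fun x ↦ x ^ s) (gammaMeasure a r) := by
  refine .of_integral_ne_zero ?_
  rw [integral_rpow_gammaMeasure ha hr hs]
  have := Real.Gamma_pos_of_pos ha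
  have := Real.Gamma_pos_of_pos hs
  positivity

theorem ae_nonneg_gammaMeasure (a r : ℝ) : ∀ᵐ x ∂(gammaMeasure a r), 0 ≤ x := by
  rw [gammaMeasure, ae_withDensity_iff (measurable_gammaPDF a r)]
  exact ae_of_all _ fun x hx ↦ not_lt.1 fun h ↦ hx (gammaPDF_of_neg h)

/-- If `S ~ Gamma(nd/p, θ₀^{−p})` (the law of `∑ Xᵢ^p` for an i.i.d. Generalized Gamma
sample), then the mean squared error of the MLE `((p/(nd)) S)^{1/p}` is
`θ₀² (1 − 2 (p/(nd))^{1/p} Γ((nd+1)/p)/Γ(nd/p) + (p/(nd))^{2/p} Γ((nd+2)/p)/Γ(nd/p))`. -/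
theorem stmt_7
    {Ω : Type*} [MeasurableSpace Ω] (μ : Measure Ω) [IsProbabilityMeasure μ]
    (d p θ₀ : ℝ) (hd : 0 < d) (hp : 0 < p) (hθ : 0 < θ₀)
    (n : ℕ) (hn : 1 ≤ n)
    (S : Ω → ℝ) (hS : Measurable S)
    (hlaw : μ.map S = gammaMeasure (n * d / p) (θ₀ ^ (-p))) :
    ∫ ω, (((p / (n * d)) * S ω) ^ (1 / p) - θ₀) ^ 2 ∂μ
      = θ₀ ^ 2 *
          (1 - 2 * (p / (n * d)) ^ (1 / p)
                * Real.Gamma ((n * d + 1) / p) / Real.Gamma (n * d / p)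
            + (p / (n * d)) ^ (2 / p)
                * Real.Gamma ((n * d + 2) / p) / Real.Gamma (n * d / p)) := by
  have hn' : (0 : ℝ) < n := by exact_mod_cast hn
  have ha : 0 < n * d / p := by positivity
  have hr : 0 < θ₀ ^ (-p) := by positivity
  have hc : 0 ≤ p / (n * d) := by positivity
  have h1 : 0 < n * d / p + 1 / p := by positivity
  have h2 : 0 < n * d / p + 2 / p := by positivity
  rw [add_div _ 1 p, add_div _ 2 p, ← integral_map (φ := S) (μ := μ)
    (f := fun x ↦ ((p / (n * d) * x) ^ (1 / p) - θ₀) ^ 2) hS.aemeasurable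
    (by fun_prop : Measurable _).aestronglyMeasurable, hlaw]
  set a := n * d / p
  set c := p / (n * d)
  have := isProbabilityMeasure_gammaMeasure ha hr
  have hexpand : ∀ᵐ x ∂(gammaMeasure a (θ₀ ^ (-p))), ((c * x) ^ (1 / p) - θ₀) ^ 2 =
      c ^ (2 / p) * x ^ (2 / p) - 2 * θ₀ * c ^ (1 / p) * x ^ (1 / p) + θ₀ ^ 2 := by
    filter_upwards [ae_nonneg_gammaMeasure a (θ₀ ^ (-p))] with x hx
    rw [← Real.mul_rpow hc hx, show 2 / p = 1 / p * (2 : ℕ) by push_cast; ring,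
      Real.rpow_mul_natCast (mul_nonneg hc hx), Real.mul_rpow hc hx]
    ring
  have hpow (k : ℕ) : (θ₀ ^ (-p)) ^ (-(k / p)) = θ₀ ^ k := by
    rw [← Real.rpow_mul hθ.le, neg_mul_neg, mul_div_cancel₀ _ hp.ne', Real.rpow_natCast]
  have hint1 := (integrable_rpow_gammaMeasure ha hr h1).const_mul (2 * θ₀ * c ^ (1 / p))
  have hint2 := (integrable_rpow_gammaMeasure ha hr h2).const_mul (c ^ (2 / p))
  have hsub : Integrable (fun x ↦ c ^ (2 / p) * x ^ (2 / p) -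
      2 * θ₀ * c ^ (1 / p) * x ^ (1 / p)) (gammaMeasure a (θ₀ ^ (-p))) := hint2.sub hint1
  have hpow1 := hpow 1
  have hpow2 := hpow 2
  push_cast at hpow1 hpow2
  rw [integral_congr_ae hexpand, integral_add hsub (integrable_const _),
    integral_sub hint2 hint1, integral_const_mul, integral_const_mul,
    integral_rpow_gammaMeasure ha hr h1, integral_rpow_gammaMeasure ha hr h2, hpow1, hpow2]
  simp only [integral_const, probReal_univ, one_smul]
  ring
end

section
/- Fix d > 0 and p > 0. Define, for integers n ≥ 1, a_n = 1 − 2·(p/(n d))^{1/p}·Γ((n d + 1)/p)/Γ(n d / p) + (p/(n d))^{2/p}·Γ((n d + 2)/p)/Γ(n d / p). Then a_n = O(1/n) as n → ∞. -/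
open Asymptotics Filter

theorem Real.log_Gamma_add_one {x : ℝ} (hx : 0 < x) :
    Real.log (Real.Gamma (x + 1)) = Real.log x + Real.log (Real.Gamma x) := by
  rw [Real.Gamma_add_one hx.ne', Real.log_mul hx.ne' (Real.Gamma_pos_of_pos hx).ne']

theorem Real.Gamma_add_div_Gamma_le {x s : ℝ} (hx : 0 < x) (hs : 0 < s) :
    Real.Gamma (x + s) / Real.Gamma x ≤ (x + s) ^ s := by
  have hxs : 0 < x + s := by positivity
  have h := Real.convexOn_log_Gamma.slope_mono_adjacent (x := x) (y := x + s) (z := x + s + 1)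
    (Set.mem_Ioi.2 hx) (Set.mem_Ioi.2 (by positivity)) (by linarith) (by linarith)
  simp only [Function.comp_apply, Real.log_Gamma_add_one hxs, add_sub_cancel_left,
    add_sub_cancel_right, div_one] at h
  rw [div_le_iff₀ hs] at h
  have hG := Real.Gamma_pos_of_pos hx
  have hG' := Real.Gamma_pos_of_pos hxs
  rw [← Real.log_le_log_iff (by positivity) (by positivity), Real.log_div hG'.ne' hG.ne',
    Real.log_rpow hxs]
  linarith

theorem Real.le_Gamma_add_div_Gamma {x s : ℝ} (hx : 1 < x) (hs : 0 < s) :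
    (x - 1) ^ s ≤ Real.Gamma (x + s) / Real.Gamma x := by
  have hx0 : 0 < x := by linarith
  have hx1 : 0 < x - 1 := by linarith
  have hxs : 0 < x + s := by positivity
  have h := Real.convexOn_log_Gamma.slope_mono_adjacent (x := x - 1) (y := x) (z := x + s)
    (Set.mem_Ioi.2 hx1) (Set.mem_Ioi.2 hxs) (by linarith) (by linarith)
  have hrec := Real.log_Gamma_add_one hx1
  rw [sub_add_cancel] at hrec
  simp only [Function.comp_apply, hrec, add_sub_cancel_left, add_sub_cancel_right,
    sub_sub_cancel, div_one] at h
  rw [le_div_iff₀ hs] at h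
  have hG := Real.Gamma_pos_of_pos hx0
  have hG' := Real.Gamma_pos_of_pos hxs
  rw [← Real.log_le_log_iff (by positivity) (by positivity), Real.log_div hG'.ne' hG.ne',
    Real.log_rpow hx1]
  linarith

theorem Real.one_add_const_mul_inv_rpow_sub_one_isBigO (c s : ℝ) :
    (fun x : ℝ => (1 + c * x⁻¹) ^ s - 1) =O[atTop] fun x : ℝ => x⁻¹ := by
  have h : HasDerivAt (fun t : ℝ => (1 + c * t) ^ s) (c * s * (1 + c * 0) ^ (s - 1)) 0 := by
    have h0 : HasDerivAt (fun t : ℝ => 1 + c * t) c 0 := by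
      simpa using ((hasDerivAt_id (0 : ℝ)).const_mul c).const_add 1
    exact h0.rpow_const (Or.inl (by simp))
  simpa [Function.comp_def] using h.isBigO_sub.comp_tendsto tendsto_inv_atTop_zero

/-- The ratio `Γ(x + s) / Γ(x)` is `x ^ s (1 + O(1/x))` as `x → ∞`. -/
theorem Real.Gamma_add_div_Gamma_div_rpow_sub_one_isBigO {s : ℝ} (hs : 0 < s) :
    (fun x : ℝ => Real.Gamma (x + s) / Real.Gamma x / x ^ s - 1)
      =O[atTop] fun x : ℝ => x⁻¹ := by
  have hsum := (Real.one_add_const_mul_inv_rpow_sub_one_isBigO (-1) s).norm_left.add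
    (Real.one_add_const_mul_inv_rpow_sub_one_isBigO s s).norm_left
  refine IsBigO.trans (IsBigO.of_bound 1 ?_) hsum
  filter_upwards [eventually_gt_atTop 1] with x hx
  have hx0 : 0 < x := by linarith
  have hlow : (1 + -1 * x⁻¹) ^ s ≤ Real.Gamma (x + s) / Real.Gamma x / x ^ s := by
    have hbase : 1 + -1 * x⁻¹ = (x - 1) / x := by field_simp; ring
    rw [hbase, Real.div_rpow (by linarith) hx0.le]
    gcongr
    exact Real.le_Gamma_add_div_Gamma hx hs
  have hupp : Real.Gamma (x + s) / Real.Gamma x / x ^ s ≤ (1 + s * x⁻¹) ^ s := by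
    have hbase : 1 + s * x⁻¹ = (x + s) / x := by field_simp
    rw [hbase, Real.div_rpow (by positivity) hx0.le]
    gcongr
    exact Real.Gamma_add_div_Gamma_le hx0 hs
  simp only [Real.norm_eq_abs, one_mul]
  refine le_trans ?_ (le_abs_self _)
  rw [abs_le]
  constructor
  · linarith [neg_abs_le ((1 + -1 * x⁻¹) ^ s - 1), abs_nonneg ((1 + s * x⁻¹) ^ s - 1)]
  · linarith [le_abs_self ((1 + s * x⁻¹) ^ s - 1), abs_nonneg ((1 + -1 * x⁻¹) ^ s - 1)]

/-- The sequence
`aₙ = 1 − 2 (p/(nd))^{1/p} Γ((nd+1)/p)/Γ(nd/p) + (p/(nd))^{2/p} Γ((nd+2)/p)/Γ(nd/p)`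
(the mean squared error of the Generalized Gamma MLE, up to the factor `θ₀²`)
is `O(1/n)` as `n → ∞`. -/
theorem stmt_9 (d p : ℝ) (hd : 0 < d) (hp : 0 < p) :
    (fun n : ℕ =>
        1 - 2 * (p / (n * d)) ^ (1 / p)
              * Real.Gamma ((n * d + 1) / p) / Real.Gamma (n * d / p)
          + (p / (n * d)) ^ (2 / p)
              * Real.Gamma ((n * d + 2) / p) / Real.Gamma (n * d / p))
      =O[atTop] fun n : ℕ => (n : ℝ)⁻¹ := by
  have hlim : Tendsto (fun n : ℕ => (n : ℝ) * d / p) atTop atTop :=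
    (tendsto_natCast_atTop_atTop.atTop_mul_const hd).atTop_div_const hp
  have hone := (Real.Gamma_add_div_Gamma_div_rpow_sub_one_isBigO
    (one_div_pos.2 hp)).comp_tendsto hlim
  have htwo := (Real.Gamma_add_div_Gamma_div_rpow_sub_one_isBigO
    (div_pos two_pos hp)).comp_tendsto hlim
  have hinv : ((fun x : ℝ => x⁻¹) ∘ fun n : ℕ => (n : ℝ) * d / p)
      =O[atTop] fun n : ℕ => (n : ℝ)⁻¹ := by
    refine (isBigO_const_mul_self (p / d) (fun n : ℕ => (n : ℝ)⁻¹) atTop).congr_left fun n => ?_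
    simp only [Function.comp_apply, inv_div]
    rw [div_mul_eq_div_div, div_right_comm, div_eq_mul_inv (p / d)]
  refine ((htwo.sub (hone.const_mul_left 2)).trans hinv).congr_left fun n => ?_
  have hpow (s : ℝ) : (p / (n * d)) ^ s = ((n * d / p) ^ s)⁻¹ := by
    rw [← Real.inv_rpow (by positivity), inv_div]
  simp only [Function.comp_apply, hpow, add_div]
  ring
end
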